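/- Every algebraic curvature tensor R of type 𝔤₁ = sp(1,1)_{ℍp} satisfies R((x, 0), (y, 0)) = 0 for all x, y ∈ ℍ; that is, R vanishes on pairs of vectors from the isotropic quaternionic line ℍp = ℍ × {0}. -/

import Mathlib

open Quaternion

noncomputable section

/-- `V = ℍ × ℍ`, the pseudo-quaternionic-Hermitian space `ℍ^{1,1}` in an isotropic basis
`p = (1,0)`, `q = (0,1)`. -/
abbrev V : Type := ℍ[ℝ] × ℍ[ℝ]

/-- The neutral-signature metric `η((x,y),(x',y')) = Re(x conj(y') + y conj(x'))`. -/
def η (u v : V) : ℝ := (u.1 * star v.2 + u.2 * star v.1).re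

/-- The endomorphism of `ℍ^{1,1}` with matrix `[[a, b], [0, -conj a]]` in the isotropic
basis `(p, q)`: `T(a,b)(x,y) = (x a + y b, − y conj(a))`. -/
def T (a b : ℍ[ℝ]) : Module.End ℝ V where
  toFun u := (u.1 * a + u.2 * b, -(u.2 * star a))
  map_add' u v := by
    simp only [Prod.fst_add, Prod.snd_add, add_mul, Prod.mk_add_mk, Prod.mk.injEq]
    constructor <;> abel
  map_smul' r u := by
    simp only [Prod.smul_fst, Prod.smul_snd, RingHom.id_apply, Prod.smul_mk,
      smul_mul_assoc, smul_add, smul_neg]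

/-- `R` is an algebraic curvature tensor of type `g`: a bilinear alternating map
`V × V → End_ℝ(V)` with values in `g` satisfying the first Bianchi identity. -/
def IsCurv (g : Set (Module.End ℝ V)) (R : V →ₗ[ℝ] V →ₗ[ℝ] Module.End ℝ V) : Prop :=
  (∀ u v : V, R u v = - R v u) ∧ (∀ u v : V, R u v ∈ g) ∧
  (∀ u v w : V, R u v w + R v w u + R w u v = 0)

/-- The Lie algebra `𝔤₁ = sp(1,1)_{ℍp}`. -/
def g1 : Set (Module.End ℝ V) := {f | ∃ a b : ℍ[ℝ], b.re = 0 ∧ f = T a b}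

theorem η_add_left (u v z : V) : η (u + v) z = η u z + η v z := by
  simp only [η, Prod.fst_add, Prod.snd_add, add_mul, re_add]
  ring

theorem η_neg_left (u z : V) : η (-u) z = -η u z := by
  simp only [η, Prod.fst_neg, Prod.snd_neg, neg_mul, re_add, re_neg]
  ring

/-- The metric `η` is nondegenerate. -/
theorem eq_zero_of_forall_η_eq_zero {u : V} (h : ∀ z, η u z = 0) : u = 0 := by
  have h₀ := h (u.2, u.1)
  simp only [η, re_add, ← Quaternion.normSq_def] at h₀
  have h₁ := Quaternion.normSq_nonneg (a := u.1)
  have h₂ := Quaternion.normSq_nonneg (a := u.2)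
  exact Prod.ext (Quaternion.normSq_eq_zero.1 (by linarith))
    (Quaternion.normSq_eq_zero.1 (by linarith))

theorem η_T_skew {a b : ℍ[ℝ]} (hb : b.re = 0) (u v : V) :
    η (T a b u) v = -η (T a b v) u := by
  simp only [η, T, LinearMap.coe_mk, AddHom.coe_mk, re_add, re_mul, re_neg, re_star,
    imI_add, imI_mul, imI_neg, imI_star, imJ_add, imJ_mul, imJ_neg, imJ_star,
    imK_add, imK_mul, imK_neg, imK_star, hb]
  ring

/-- A tensor of curvature type whose values are `η`-skew is symmetric under exchange of pairs. -/
theorem IsCurv.pair_symm {g : Set (Module.End ℝ V)} {R : V →ₗ[ℝ] V →ₗ[ℝ] Module.End ℝ V}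
    (hR : IsCurv g R) (hg : ∀ f ∈ g, ∀ u v, η (f u) v = -η (f v) u) (u v w z : V) :
    η (R u v w) z = η (R w z u) v := by
  obtain ⟨halt, hmem, hbianchi⟩ := hR
  have hA (u v w z : V) : η (R u v w) z = -η (R v u w) z := by
    rw [halt u v, LinearMap.neg_apply, η_neg_left]
  have hS (u v w z : V) : η (R u v w) z = -η (R u v z) w := hg _ (hmem u v) w z
  have hB (u v w z : V) : η (R u v w) z + η (R v w u) z + η (R w u v) z = 0 := by
    rw [← η_add_left, ← η_add_left, hbianchi]
    simp [η]
  linarith [hB u v w z, hB v w z u, hB w z u v, hB z u v w,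
    hS u v w z, hS v w z u, hS w z u v, hS z u v w, hS w u v z, hS v z u w,
    hA w u v z, hA w u z v, hA v z w u, hA v z u w, hA z u v w, hA z u w v]

/-- every curvature tensor of type `sp(1,1)_{ℍp}` vanishes on pairs of
vectors from the isotropic quaternionic line `ℍp = ℍ × {0}`. -/
theorem curvature_vanishes_on_Hp
    (R : V →ₗ[ℝ] V →ₗ[ℝ] Module.End ℝ V) (hR : IsCurv g1 R) :
    ∀ x y : ℍ[ℝ], R (x, 0) (y, 0) = 0 := by
  intro x y
  have hg : ∀ f ∈ g1, ∀ u v, η (f u) v = -η (f v) u := by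
    rintro _ ⟨a, b, hb, rfl⟩
    exact η_T_skew hb
  refine LinearMap.ext fun w => eq_zero_of_forall_η_eq_zero fun z => ?_
  rw [hR.pair_symm hg]
  obtain ⟨a, b, -, hab⟩ := hR.2.1 w z
  simp [hab, T, η]

end
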